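/- arXiv:1707.04081 — 13 statements merged into one kernel-verified Lean document; each statement's English description precedes it below -/
import Mathlib

section
/- Let a, b, c, r, s, t be real numbers, let V_n = V_n(a,b,c;r,s,t) be the generalized Tribonacci sequence, and let U_n = V_n(0,0,1;r,s,t). Then for every n ≥ 2, V_n = c·U_n + (b·s + a·t)·U_{n-1} + b·t·U_{n-2}. -/
/-- The generalized Tribonacci sequence `V n = V n (a,b,c;r,s,t)`. -/
def genTribonacci (a b c r s t : ℝ) : ℕ → ℝ
  | 0 => a
  | 1 => b
  | 2 => c
  | (n+3) => r * genTribonacci a b c r s t (n+2) + s * genTribonacci a b c r s t (n+1)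
      + t * genTribonacci a b c r s t n

theorem genTribonacci_add_three (a b c r s t : ℝ) (n : ℕ) :
    genTribonacci a b c r s t (n + 3) =
      r * genTribonacci a b c r s t (n + 2) + s * genTribonacci a b c r s t (n + 1)
        + t * genTribonacci a b c r s t n := by
  rw [genTribonacci]

theorem genTribonacci_add_two_eq_comb (a b c r s t : ℝ) (n : ℕ) :
    genTribonacci a b c r s t (n + 2) =
      c * genTribonacci 0 0 1 r s t (n + 2)
        + (b * s + a * t) * genTribonacci 0 0 1 r s t (n + 1)
        + b * t * genTribonacci 0 0 1 r s t n := by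
  induction n using Nat.strong_induction_on with
  | _ n ih =>
    match n, ih with
    | 0, _ => simp [genTribonacci]
    | 1, _ => simp [genTribonacci]; ring
    | 2, _ => simp [genTribonacci]; ring
    | n + 3, ih =>
      have h₀ := ih n (by omega)
      have h₁ := ih (n + 1) (by omega)
      have h₂ := ih (n + 2) (by omega)
      linear_combination r * h₂ + s * h₁ + t * h₀
        + genTribonacci_add_three a b c r s t (n + 2)
        - c * genTribonacci_add_three 0 0 1 r s t (n + 2)
        - (b * s + a * t) * genTribonacci_add_three 0 0 1 r s t (n + 1)
        - b * t * genTribonacci_add_three 0 0 1 r s t n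

theorem genTribonacci_eq_comb (a b c r s t : ℝ) (n : ℕ) (hn : 2 ≤ n) :
    genTribonacci a b c r s t n =
      c * genTribonacci 0 0 1 r s t n
        + (b * s + a * t) * genTribonacci 0 0 1 r s t (n - 1)
        + b * t * genTribonacci 0 0 1 r s t (n - 2) := by
  obtain ⟨m, rfl⟩ := Nat.exists_eq_add_of_le' hn
  exact genTribonacci_add_two_eq_comb a b c r s t m
end

section
/- Let a, b, c, r, s, t be real numbers, let V_n = V_n(a,b,c;r,s,t) be the generalized Tribonacci sequence, and let Q_{v,n} = V_n + V_{n+1}·i + V_{n+2}·j + V_{n+3}·k, regarded as quaternions over ℂ. Let α, ω₁, ω₂ be pairwise distinct complex roots of x³ − r·x² − s·x − t = 0, set P = c − (ω₁+ω₂)·b + ω₁·ω₂·a, Q = c − (α+ω₂)·b + α·ω₂·a, R = c − (α+ω₁)·b + α·ω₁·a, and for a complex number z let z̲ denote the quaternion 1 + z·i + z²·j + z³·k over ℂ. Then for every n ≥ 0, Q_{v,n} = P·α̲·αⁿ/((α−ω₁)(α−ω₂)) − Q·ω̲₁·ω₁ⁿ/((α−ω₁)(ω₁−ω₂)) + R·ω̲₂·ω₂ⁿ/((α−ω₂)(ω₁−ω₂)).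 -/
/-- The generalized Tribonacci quaternion `Q_{v,n} = V_n + V_{n+1} i + V_{n+2} j + V_{n+3} k`,
regarded as a quaternion over `ℂ`. -/
noncomputable def genTribonacciQuatC (a b c r s t : ℝ) (n : ℕ) : Quaternion ℂ :=
  ⟨(genTribonacci a b c r s t n : ℂ), (genTribonacci a b c r s t (n+1) : ℂ),
    (genTribonacci a b c r s t (n+2) : ℂ), (genTribonacci a b c r s t (n+3) : ℂ)⟩

/-- For a complex number `z`, the quaternion `z̲ = 1 + z i + z² j + z³ k`. -/
noncomputable def underline (z : ℂ) : Quaternion ℂ := ⟨1, z, z ^ 2, z ^ 3⟩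

/-- A linear combination of powers of roots of the characteristic polynomial that agrees with
the generalized Tribonacci sequence at `0, 1, 2` agrees with it everywhere. -/
theorem genTribonacci_eq_of_initial (a b c r s t : ℝ) {x y z A B C : ℂ}
    (hx : x ^ 3 - (r : ℂ) * x ^ 2 - (s : ℂ) * x - (t : ℂ) = 0)
    (hy : y ^ 3 - (r : ℂ) * y ^ 2 - (s : ℂ) * y - (t : ℂ) = 0)
    (hz : z ^ 3 - (r : ℂ) * z ^ 2 - (s : ℂ) * z - (t : ℂ) = 0)
    (h0 : (a : ℂ) = A + B + C)
    (h1 : (b : ℂ) = A * x + B * y + C * z)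
    (h2 : (c : ℂ) = A * x ^ 2 + B * y ^ 2 + C * z ^ 2) (n : ℕ) :
    (genTribonacci a b c r s t n : ℂ) = A * x ^ n + B * y ^ n + C * z ^ n := by
  induction n using Nat.strong_induction_on with
  | _ n ih =>
    match n, ih with
    | 0, _ => simpa [genTribonacci] using h0
    | 1, _ => simpa [genTribonacci] using h1
    | 2, _ => simpa [genTribonacci] using h2
    | n + 3, ih =>
      have e0 := ih n (by omega)
      have e1 := ih (n + 1) (by omega)
      have e2 := ih (n + 2) (by omega)
      rw [genTribonacci]
      push_cast
      linear_combination (r : ℂ) * e2 + (s : ℂ) * e1 + (t : ℂ) * e0 - A * x ^ n * hx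
        - B * y ^ n * hy - C * z ^ n * hz

/-- The Binet formula for the generalized Tribonacci sequence. -/
theorem genTribonacci_binet (a b c r s t : ℝ) {x y z : ℂ}
    (hx : x ^ 3 - (r : ℂ) * x ^ 2 - (s : ℂ) * x - (t : ℂ) = 0)
    (hy : y ^ 3 - (r : ℂ) * y ^ 2 - (s : ℂ) * y - (t : ℂ) = 0)
    (hz : z ^ 3 - (r : ℂ) * z ^ 2 - (s : ℂ) * z - (t : ℂ) = 0)
    (hxy : x ≠ y) (hxz : x ≠ z) (hyz : y ≠ z) (n : ℕ) :
    (genTribonacci a b c r s t n : ℂ) =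
      ((c : ℂ) - (y + z) * b + y * z * a) / ((x - y) * (x - z)) * x ^ n
        + -(((c : ℂ) - (x + z) * b + x * z * a) / ((x - y) * (y - z))) * y ^ n
        + ((c : ℂ) - (x + y) * b + x * y * a) / ((x - z) * (y - z)) * z ^ n := by
  have hxy' := sub_ne_zero.mpr hxy
  have hxz' := sub_ne_zero.mpr hxz
  have hyz' := sub_ne_zero.mpr hyz
  apply genTribonacci_eq_of_initial a b c r s t hx hy hz <;>
  · field_simp
    ring

theorem genTribonacciQuat_binet (a b c r s t : ℝ) (α ω₁ ω₂ : ℂ)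
    (hα : α ^ 3 - (r : ℂ) * α ^ 2 - (s : ℂ) * α - (t : ℂ) = 0)
    (hω₁ : ω₁ ^ 3 - (r : ℂ) * ω₁ ^ 2 - (s : ℂ) * ω₁ - (t : ℂ) = 0)
    (hω₂ : ω₂ ^ 3 - (r : ℂ) * ω₂ ^ 2 - (s : ℂ) * ω₂ - (t : ℂ) = 0)
    (h₁ : α ≠ ω₁) (h₂ : α ≠ ω₂) (h₃ : ω₁ ≠ ω₂)
    (P Q R : ℂ)
    (hP : P = (c : ℂ) - (ω₁ + ω₂) * b + ω₁ * ω₂ * a)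
    (hQ : Q = (c : ℂ) - (α + ω₂) * b + α * ω₂ * a)
    (hR : R = (c : ℂ) - (α + ω₁) * b + α * ω₁ * a) (n : ℕ) :
    genTribonacciQuatC a b c r s t n =
      (P * α ^ n / ((α - ω₁) * (α - ω₂))) • underline α
        - (Q * ω₁ ^ n / ((α - ω₁) * (ω₁ - ω₂))) • underline ω₁
        + (R * ω₂ ^ n / ((α - ω₂) * (ω₁ - ω₂))) • underline ω₂ := by
  have binet := genTribonacci_binet a b c r s t hα hω₁ hω₂ h₁ h₂ h₃
  subst hP hQ hR
  ext <;> simp only [Quaternion.re_add, Quaternion.imI_add, Quaternion.imJ_add,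
    Quaternion.imK_add, Quaternion.re_sub, Quaternion.imI_sub, Quaternion.imJ_sub,
    Quaternion.imK_sub, Quaternion.re_smul, Quaternion.imI_smul, Quaternion.imJ_smul,
    Quaternion.imK_smul, smul_eq_mul] <;>
  · simp only [genTribonacciQuatC, underline, binet]
    ring
end

section
/- Let a, b, c, r, s, t be real numbers and let V_n = V_n(a,b,c;r,s,t) be the generalized Tribonacci sequence. Set δ = r + s + t − 1. Then for every integer n ≥ 0, δ · Σ_{l=0}^{n} V_l = V_{n+2} + (1−r)·V_{n+1} + t·V_n + (r+s−1)·a + (r−1)·b − c. -/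
theorem genTribonacci_sum (a b c r s t : ℝ) (n : ℕ) :
    (r + s + t - 1) * ∑ l ∈ Finset.range (n + 1), genTribonacci a b c r s t l =
      genTribonacci a b c r s t (n + 2) + (1 - r) * genTribonacci a b c r s t (n + 1)
        + t * genTribonacci a b c r s t n + ((r + s - 1) * a + (r - 1) * b - c) := by
  induction n with
  | zero =>
    simp only [zero_add, Finset.sum_range_one, genTribonacci]
    ring
  | succ n ih =>
    rw [Finset.sum_range_succ, mul_add, ih, show n + 1 + 2 = n + 3 from rfl,
      genTribonacci.eq_4]
    ring
end

section
/- Let a, b, c, r, s, t be real numbers, let V_n = V_n(a,b,c;r,s,t) be the generalized Tribonacci sequence, and let Q_{v,n} = V_n + V_{n+1}·i + V_{n+2}·j + V_{n+3}·k be the generalized Tribonacci quaternion. Set δ = r + s + t − 1, λ = (r+s−1)·a + (r−1)·b − c, and ω = λ + (λ − δ·a)·i + (λ − δ·(a+b))·j + (λ − δ·(a+b+c))·k. Then for every integer n ≥ 0, δ · Σ_{l=0}^{n} Q_{v,l} = Q_{v,n+2} + (1−r)·Q_{v,n+1} + t·Q_{v,n} + ω. -/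
/-- The generalized Tribonacci quaternion `Q_{v,n} = V_n + V_{n+1} i + V_{n+2} j + V_{n+3} k`. -/
noncomputable def genTribonacciQuat (a b c r s t : ℝ) (n : ℕ) : Quaternion ℝ :=
  ⟨genTribonacci a b c r s t n, genTribonacci a b c r s t (n+1),
    genTribonacci a b c r s t (n+2), genTribonacci a b c r s t (n+3)⟩

@[simp]
theorem re_genTribonacciQuat (a b c r s t : ℝ) (n : ℕ) :
    (genTribonacciQuat a b c r s t n).re = genTribonacci a b c r s t n := rfl

@[simp]
theorem imI_genTribonacciQuat (a b c r s t : ℝ) (n : ℕ) :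
    (genTribonacciQuat a b c r s t n).imI = genTribonacci a b c r s t (n + 1) := rfl

@[simp]
theorem imJ_genTribonacciQuat (a b c r s t : ℝ) (n : ℕ) :
    (genTribonacciQuat a b c r s t n).imJ = genTribonacci a b c r s t (n + 2) := rfl

@[simp]
theorem imK_genTribonacciQuat (a b c r s t : ℝ) (n : ℕ) :
    (genTribonacciQuat a b c r s t n).imK = genTribonacci a b c r s t (n + 3) := rfl

theorem genTribonacciQuat_add_three (a b c r s t : ℝ) (n : ℕ) :
    genTribonacciQuat a b c r s t (n + 3) =
      r • genTribonacciQuat a b c r s t (n + 2) + s • genTribonacciQuat a b c r s t (n + 1)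
        + t • genTribonacciQuat a b c r s t n := by
  apply Quaternion.ext <;> simp [genTribonacci]

theorem genTribonacciQuat_sum (a b c r s t : ℝ) (δ lam : ℝ) (ω : Quaternion ℝ)
    (hδ : δ = r + s + t - 1)
    (hlam : lam = (r + s - 1) * a + (r - 1) * b - c)
    (hω : ω = ⟨lam, lam - δ * a, lam - δ * (a + b), lam - δ * (a + b + c)⟩) (n : ℕ) :
    δ • ∑ l ∈ Finset.range (n + 1), genTribonacciQuat a b c r s t l =
      genTribonacciQuat a b c r s t (n + 2)
        + (1 - r) • genTribonacciQuat a b c r s t (n + 1)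
        + t • genTribonacciQuat a b c r s t n + ω := by
  induction n with
  | zero =>
    rw [zero_add, Finset.sum_range_one]
    apply Quaternion.ext <;> simp [genTribonacci] <;> simp only [hω, hlam, hδ] <;> ring
  | succ n ih =>
    rw [Finset.sum_range_succ, smul_add, ih, genTribonacciQuat_add_three, hδ]
    module
end

section
/- Let a, b, c, r, s, t be real numbers and let V_n = V_n(a,b,c;r,s,t) be the generalized Tribonacci sequence. Let α, ω₁, ω₂ be pairwise distinct complex roots of x³ − r·x² − s·x − t = 0, set P = c − (ω₁+ω₂)·b + ω₁·ω₂·a, Q = c − (α+ω₂)·b + α·ω₂·a, R = c − (α+ω₁)·b + α·ω₁·a, and φ = (α−ω₁)(α−ω₂)(ω₁−ω₂). For a complex number z let z̄̄ = 1 + z² + z⁴ + z⁶ and for complex z, w let ⟨zw⟩ = 1 + zw + (zw)² + (zw)³. Then for every n ≥ 0, φ² · (V_n² + V_{n+1}² + V_{n+2}² + V_{n+3}²) = (ω₁−ω₂)²·P²·ᾱ̄·α^{2n} + (α−ω₂)²·Q²·ω̄̄₁·ω₁^{2n} + (α−ω₁)²·R²·ω̄̄₂·ω₂^{2n} − 2·[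 (ω₁−ω₂)(α−ω₂)·P·Q·⟨αω₁⟩·(αω₁)ⁿ + (ω₁−ω₂)(ω₁−α)·P·R·⟨αω₂⟩·(αω₂)ⁿ + (α−ω₁)(α−ω₂)·Q·R·⟨ω₁ω₂⟩·(ω₁ω₂)ⁿ ] (an identity of complex numbers, where V_m is viewed in ℂ). In particular the left-hand side equals φ² times the squared norm of the generalized Tribonacci quaternion Q_{v,n}. -/
/-- `z̄̄ = 1 + z² + z⁴ + z⁶`. -/
def bbar (z : ℂ) : ℂ := 1 + z ^ 2 + z ^ 4 + z ^ 6

/-- `⟨zw⟩ = 1 + zw + (zw)² + (zw)³`. -/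
def ubar (z w : ℂ) : ℂ := 1 + z * w + (z * w) ^ 2 + (z * w) ^ 3

/-- Binet formula for the generalized Tribonacci sequence, cleared of denominators. -/
theorem genTribonacci_binet_s8 (a b c r s t : ℝ) (α ω₁ ω₂ : ℂ)
    (hα : α ^ 3 - (r : ℂ) * α ^ 2 - (s : ℂ) * α - (t : ℂ) = 0)
    (hω₁ : ω₁ ^ 3 - (r : ℂ) * ω₁ ^ 2 - (s : ℂ) * ω₁ - (t : ℂ) = 0)
    (hω₂ : ω₂ ^ 3 - (r : ℂ) * ω₂ ^ 2 - (s : ℂ) * ω₂ - (t : ℂ) = 0) (n : ℕ) :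
    (α - ω₁) * (α - ω₂) * (ω₁ - ω₂) * (genTribonacci a b c r s t n : ℂ) =
      (ω₁ - ω₂) * (c - (ω₁ + ω₂) * b + ω₁ * ω₂ * a) * α ^ n
        - (α - ω₂) * (c - (α + ω₂) * b + α * ω₂ * a) * ω₁ ^ n
        + (α - ω₁) * (c - (α + ω₁) * b + α * ω₁ * a) * ω₂ ^ n := by
  induction n using genTribonacci.induct with
  | case1 => simp only [genTribonacci]; ring
  | case2 => simp only [genTribonacci]; ring
  | case3 => simp only [genTribonacci]; ring
  | case4 n ih₂ ih₁ ih₀ =>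
    simp only [genTribonacci, Nat.succ_eq_add_one]
    push_cast
    linear_combination (r : ℂ) * ih₂ + (s : ℂ) * ih₁ + (t : ℂ) * ih₀
      - (ω₁ - ω₂) * (c - (ω₁ + ω₂) * b + ω₁ * ω₂ * a) * α ^ n * hα
      + (α - ω₂) * (c - (α + ω₂) * b + α * ω₂ * a) * ω₁ ^ n * hω₁
      - (α - ω₁) * (c - (α + ω₁) * b + α * ω₁ * a) * ω₂ ^ n * hω₂

theorem genTribonacciQuat_norm (a b c r s t : ℝ) (α ω₁ ω₂ : ℂ)
    (hα : α ^ 3 - (r : ℂ) * α ^ 2 - (s : ℂ) * α - (t : ℂ) = 0)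
    (hω₁ : ω₁ ^ 3 - (r : ℂ) * ω₁ ^ 2 - (s : ℂ) * ω₁ - (t : ℂ) = 0)
    (hω₂ : ω₂ ^ 3 - (r : ℂ) * ω₂ ^ 2 - (s : ℂ) * ω₂ - (t : ℂ) = 0)
    (h₁ : α ≠ ω₁) (h₂ : α ≠ ω₂) (h₃ : ω₁ ≠ ω₂)
    (P Q R φ : ℂ)
    (hP : P = (c : ℂ) - (ω₁ + ω₂) * b + ω₁ * ω₂ * a)
    (hQ : Q = (c : ℂ) - (α + ω₂) * b + α * ω₂ * a)
    (hR : R = (c : ℂ) - (α + ω₁) * b + α * ω₁ * a)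
    (hφ : φ = (α - ω₁) * (α - ω₂) * (ω₁ - ω₂)) (n : ℕ) :
    φ ^ 2 * ((genTribonacci a b c r s t n : ℂ) ^ 2
          + (genTribonacci a b c r s t (n+1) : ℂ) ^ 2
          + (genTribonacci a b c r s t (n+2) : ℂ) ^ 2
          + (genTribonacci a b c r s t (n+3) : ℂ) ^ 2) =
        (ω₁ - ω₂) ^ 2 * P ^ 2 * bbar α * α ^ (2 * n)
          + (α - ω₂) ^ 2 * Q ^ 2 * bbar ω₁ * ω₁ ^ (2 * n)
          + (α - ω₁) ^ 2 * R ^ 2 * bbar ω₂ * ω₂ ^ (2 * n)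
          - 2 * ((ω₁ - ω₂) * (α - ω₂) * P * Q * ubar α ω₁ * (α * ω₁) ^ n
              + (ω₁ - ω₂) * (ω₁ - α) * P * R * ubar α ω₂ * (α * ω₂) ^ n
              + (α - ω₁) * (α - ω₂) * Q * R * ubar ω₁ ω₂ * (ω₁ * ω₂) ^ n)
      ∧ φ ^ 2 * ((genTribonacci a b c r s t n : ℂ) ^ 2
          + (genTribonacci a b c r s t (n+1) : ℂ) ^ 2
          + (genTribonacci a b c r s t (n+2) : ℂ) ^ 2
          + (genTribonacci a b c r s t (n+3) : ℂ) ^ 2) =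
        φ ^ 2 * ((Quaternion.normSq (genTribonacciQuat a b c r s t n) : ℝ) : ℂ) := by
  constructor
  · have binet : ∀ m, φ * (genTribonacci a b c r s t m : ℂ) =
        (ω₁ - ω₂) * P * α ^ m - (α - ω₂) * Q * ω₁ ^ m + (α - ω₁) * R * ω₂ ^ m := by
      intro m
      rw [hφ, hP, hQ, hR]
      exact genTribonacci_binet_s8 a b c r s t α ω₁ ω₂ hα hω₁ hω₂ m
    simp only [mul_add, ← mul_pow φ, binet]
    unfold bbar ubar
    ring
  · rw [Quaternion.normSq_def']
    simp [genTribonacciQuat]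
end

section
/- Let a, b, c, r, s, t be real numbers with t ≠ 0, let V_n = V_n(a,b,c;r,s,t) be the generalized Tribonacci sequence, and let Q_{v,n} = V_n + V_{n+1}·i + V_{n+2}·j + V_{n+3}·k be the generalized Tribonacci quaternion. Then for every n ≥ 0, Q_{v,3n} = Σ_{l=0}^{n} Σ_{m=0}^{l} C(n,l)·C(l,m)·r^m·s^{l−m}·t^{n−l}·Q_{v,l+m}, where C(n,l) denotes the binomial coefficient. -/
open Polynomial in
/-- The polynomial identity behind the binomial formula for third-order recurrences. -/
theorem cubic_pow_expand {R : Type*} [CommRing R] (r s t : R) (n : ℕ) :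
    (C r * X ^ 2 + C s * X + C t : R[X]) ^ n =
      ∑ l ∈ Finset.range (n + 1), ∑ m ∈ Finset.range (l + 1),
        C ((n.choose l : R) * (l.choose m : R) * r ^ m * s ^ (l - m) * t ^ (n - l)) *
          X ^ (l + m) := by
  have h : (C r * X ^ 2 + C s * X + C t : R[X]) = X * (C r * X + C s) + C t := by ring
  rw [h, add_pow]
  refine Finset.sum_congr rfl fun l _ => ?_
  rw [mul_pow, add_pow, Finset.mul_sum, Finset.sum_mul, Finset.sum_mul]
  refine Finset.sum_congr rfl fun m _ => ?_
  simp only [map_mul, map_pow, map_natCast]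
  ring

/-- Evaluating a polynomial at the shift operator sends `X ^ k` to the shift by `k`. -/
theorem funLeft_succ_pow_apply {R M : Type*} [CommRing R] [AddCommGroup M] [Module R M]
    (v : ℕ → M) (k n : ℕ) :
    ((LinearMap.funLeft R M Nat.succ : Module.End R (ℕ → M)) ^ k) v n = v (n + k) := by
  induction k generalizing n with
  | zero => simp
  | succ k ih =>
    rw [pow_succ', Module.End.mul_apply, LinearMap.funLeft_apply, ih, Nat.succ_add_eq_add_succ]

open Polynomial in
theorem binomial_sum_of_third_order_recurrence {R M : Type*} [CommRing R] [AddCommGroup M]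
    [Module R M] (r s t : R) (v : ℕ → M)
    (hv : ∀ n, v (n + 3) = r • v (n + 2) + s • v (n + 1) + t • v n) (n : ℕ) :
    v (3 * n) = ∑ l ∈ Finset.range (n + 1), ∑ m ∈ Finset.range (l + 1),
      ((n.choose l : R) * (l.choose m : R) * r ^ m * s ^ (l - m) * t ^ (n - l)) •
        v (l + m) := by
  let E : Module.End R (ℕ → M) := LinearMap.funLeft R M Nat.succ
  have hE (k j : ℕ) : (E ^ k) v j = v (j + k) := funLeft_succ_pow_apply v k j
  have hE1 (j : ℕ) : E v j = v (j + 1) := rfl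
  have hroot : aeval E (X ^ 3 - (C r * X ^ 2 + C s * X + C t)) v = 0 := by
    ext j
    simp [hE, hE1, hv, Algebra.algebraMap_eq_smul_one]
  obtain ⟨q, hq⟩ := sub_dvd_pow_sub_pow (X ^ 3 : R[X]) (C r * X ^ 2 + C s * X + C t) n
  have hpow : aeval E ((X ^ 3) ^ n - (C r * X ^ 2 + C s * X + C t) ^ n) v = 0 := by
    rw [hq, mul_comm, map_mul, Module.End.mul_apply, hroot, map_zero]
  rw [cubic_pow_expand, ← pow_mul, map_sub, LinearMap.sub_apply, sub_eq_zero] at hpow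
  have h0 := congrFun hpow 0
  simpa only [map_sum, C_mul', map_smul, aeval_X_pow, LinearMap.sum_apply, Finset.sum_apply,
    LinearMap.smul_apply, Pi.smul_apply, hE, zero_add] using h0

theorem genTribonacciQuat_binomial_sum (a b c r s t : ℝ) (ht : t ≠ 0) (n : ℕ) :
    genTribonacciQuat a b c r s t (3 * n) =
      ∑ l ∈ Finset.range (n + 1), ∑ m ∈ Finset.range (l + 1),
        ((n.choose l : ℝ) * (l.choose m : ℝ) * r ^ m * s ^ (l - m) * t ^ (n - l)) •
          genTribonacciQuat a b c r s t (l + m) := by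
  exact binomial_sum_of_third_order_recurrence r s t _
    (genTribonacciQuat_add_three a b c r s t) n
end

section
/- Let r, s, t be real numbers, let U_n = V_n(0,0,1;r,s,t), and let S be the 3×3 real matrix with rows (r, s, t), (1, 0, 0), (0, 1, 0). Then for every n ≥ 2, Sⁿ is the matrix with rows (U_{n+2}, s·U_{n+1} + t·U_n, t·U_{n+1}), (U_{n+1}, s·U_n + t·U_{n-1}, t·U_n), (U_n, s·U_{n-1} + t·U_{n-2}, t·U_{n-1}). -/
theorem genTribonacci_S_matrix_pow (r s t : ℝ) (n : ℕ) (hn : 2 ≤ n) :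
    (!![r, s, t; 1, 0, 0; 0, 1, 0] : Matrix (Fin 3) (Fin 3) ℝ) ^ n =
      let U := genTribonacci 0 0 1 r s t
      !![U (n + 2), s * U (n + 1) + t * U n, t * U (n + 1);
         U (n + 1), s * U n + t * U (n - 1), t * U n;
         U n, s * U (n - 1) + t * U (n - 2), t * U (n - 1)] := by
  extract_lets U
  have hU (m : ℕ) : U (m + 3) = r * U (m + 2) + s * U (m + 1) + t * U m := rfl
  obtain ⟨k, rfl⟩ := Nat.exists_eq_add_of_le' hn
  clear hn
  induction k with
  | zero =>
    have h0 : U 0 = 0 := rfl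
    have h1 : U 1 = 0 := rfl
    have h2 : U 2 = 1 := rfl
    have h3 : U 3 = r := by simp [hU 0, h0, h1, h2]
    have h4 : U 4 = r * r + s := by simp [hU 1, h1, h2, h3]
    ext i j
    fin_cases i <;> fin_cases j <;>
      simp [pow_two, Matrix.mul_apply, Fin.sum_univ_three, h0, h1, h2, h3, h4, mul_comm]
  | succ k ih =>
    rw [show k + 1 + 2 = (k + 2) + 1 from rfl, pow_succ', ih]
    have h3 := hU k
    have h4 := hU (k + 1)
    have h5 := hU (k + 2)
    ext i j
    fin_cases i <;> fin_cases j <;>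
      simp [Matrix.mul_apply, Fin.sum_univ_three] <;> grind
end

section
/- Let a, b, c, r, s, t be real numbers, let V_n = V_n(a,b,c;r,s,t) be the generalized Tribonacci sequence, and let Q_{v,n} = V_n + V_{n+1}·i + V_{n+2}·j + V_{n+3}·k be the generalized Tribonacci quaternion. Let S be the 3×3 matrix (over the real quaternions) with rows (r, s, t), (1, 0, 0), (0, 1, 0), and let Q_S be the 3×3 quaternion matrix with rows (Q_{v,4}, s·Q_{v,3} + t·Q_{v,2}, t·Q_{v,3}), (Q_{v,3}, s·Q_{v,2} + t·Q_{v,1}, t·Q_{v,2}), (Q_{v,2}, s·Q_{v,1} + t·Q_{v,0}, t·Q_{v,1}). Then for every n ≥ 0, Q_S · Sⁿ is the matrix with rows (Q_{v,n+4}, s·Q_{v,n+3} + t·Q_{v,n+2}, t·Q_{v,n+3}), (Q_{v,n+3}, s·Q_{v,n+2} + t·Q_{v,n+1}, t·Q_{v,n+2}), (Q_{v,n+2}, s·Q_{v,n+1} + t·Q_{v,n}, t·Q_{v,n+1}). -/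
theorem genTribonacciQuat_matrix (a b c r s t : ℝ) (n : ℕ) :
    let Q := genTribonacciQuat a b c r s t
    let S : Matrix (Fin 3) (Fin 3) (Quaternion ℝ) :=
      !![(r : Quaternion ℝ), (s : Quaternion ℝ), (t : Quaternion ℝ); 1, 0, 0; 0, 1, 0]
    let QS : Matrix (Fin 3) (Fin 3) (Quaternion ℝ) :=
      !![Q 4, s • Q 3 + t • Q 2, t • Q 3;
         Q 3, s • Q 2 + t • Q 1, t • Q 2;
         Q 2, s • Q 1 + t • Q 0, t • Q 1]
    QS * S ^ n =
      !![Q (n + 4), s • Q (n + 3) + t • Q (n + 2), t • Q (n + 3);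
         Q (n + 3), s • Q (n + 2) + t • Q (n + 1), t • Q (n + 2);
         Q (n + 2), s • Q (n + 1) + t • Q n, t • Q (n + 1)] := by
  intro Q S QS
  have hQ (m : ℕ) : Q (m + 3) = r • Q (m + 2) + s • Q (m + 1) + t • Q m :=
    genTribonacciQuat_add_three a b c r s t m
  induction n with
  | zero => simp [QS]
  | succ n ih =>
    rw [pow_succ, ← mul_assoc, ih]
    ext1 i j
    fin_cases i <;> fin_cases j <;>
      simp [S, Matrix.mul_apply, Fin.sum_univ_three, Quaternion.mul_coe_eq_smul, add_right_comm n 1,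
        hQ (n + 2), hQ (n + 1), hQ n, add_assoc]
end

section
/- Let T_n be the Tribonacci sequence (T_0 = 0, T_1 = 0, T_2 = 1, T_n = T_{n-1} + T_{n-2} + T_{n-3} for n ≥ 3) and let Q_n = T_n + T_{n+1}·i + T_{n+2}·j + T_{n+3}·k be the Tribonacci quaternion. Then for every n ≥ 0, Σ_{l=0}^{n} Q_l = (1/2)·(Q_{n+2} + Q_n − (1 + i + j + 3k)). -/
/-- The Tribonacci sequence: `T 0 = 0`, `T 1 = 0`, `T 2 = 1`. -/
def trib : ℕ → ℝ
  | 0 => 0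
  | 1 => 0
  | 2 => 1
  | (n+3) => trib (n+2) + trib (n+1) + trib n

/-- The Tribonacci quaternion `Q_n = T_n + T_{n+1} i + T_{n+2} j + T_{n+3} k`. -/
noncomputable def tribQuat (n : ℕ) : Quaternion ℝ :=
  ⟨trib n, trib (n+1), trib (n+2), trib (n+3)⟩

/-- Partial sums of a sequence satisfying the Tribonacci recurrence in a real vector space. -/
theorem sum_range_succ_of_trib_rec {E : Type*} [AddCommGroup E] [Module ℝ E] (u : ℕ → E)
    (hu : ∀ n, u (n + 3) = u (n + 2) + u (n + 1) + u n) (n : ℕ) :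
    ∑ l ∈ Finset.range (n + 1), u l = (1 / 2 : ℝ) • (u (n + 2) + u n - (u 2 - u 0)) := by
  induction n with
  | zero =>
    rw [Finset.sum_range_one]
    module
  | succ n ih =>
    rw [Finset.sum_range_succ, ih, show n + 1 + 2 = n + 3 from rfl, hu]
    module

theorem tribQuat_add_three (n : ℕ) :
    tribQuat (n + 3) = tribQuat (n + 2) + tribQuat (n + 1) + tribQuat n :=
  rfl

theorem tribQuat_two_sub_tribQuat_zero : tribQuat 2 - tribQuat 0 = ⟨1, 1, 1, 3⟩ := by
  apply Quaternion.ext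
  · change trib 2 - trib 0 = 1
    norm_num [trib]
  · change trib 3 - trib 1 = 1
    norm_num [trib]
  · change trib 4 - trib 2 = 1
    norm_num [trib]
  · change trib 5 - trib 3 = 3
    norm_num [trib]

theorem tribQuat_sum (n : ℕ) :
    ∑ l ∈ Finset.range (n + 1), tribQuat l =
      (1 / 2 : ℝ) • (tribQuat (n + 2) + tribQuat n - ⟨1, 1, 1, 3⟩) := by
  rw [← tribQuat_two_sub_tribQuat_zero]
  exact sum_range_succ_of_trib_rec tribQuat tribQuat_add_three n
end

section
/- Let N_n be the Narayana sequence (N_0 = 0, N_1 = 1, N_2 = 1, N_n = N_{n-1} + N_{n-3} for n ≥ 3) and let Q_n = N_n + N_{n+1}·i + N_{n+2}·j + N_{n+3}·k be the Narayana quaternion. Then for every n ≥ 0, Σ_{l=0}^{n} Q_l = Q_{n+3} − (1 + i + 2j + 3k). -/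
/-- The Narayana sequence: `N 0 = 0`, `N 1 = 1`, `N 2 = 1`, `N n = N (n-1) + N (n-3)`. -/
def narayana : ℕ → ℝ
  | 0 => 0
  | 1 => 1
  | 2 => 1
  | (n+3) => narayana (n+2) + narayana n

/-- The Narayana quaternion `Q_n = N_n + N_{n+1} i + N_{n+2} j + N_{n+3} k`. -/
noncomputable def narayanaQuat (n : ℕ) : Quaternion ℝ :=
  ⟨narayana n, narayana (n+1), narayana (n+2), narayana (n+3)⟩

/-- The Narayana quaternions satisfy the recurrence of the Narayana sequence. -/
theorem narayanaQuat_add_four (n : ℕ) :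
    narayanaQuat (n + 4) = narayanaQuat (n + 3) + narayanaQuat (n + 1) :=
  rfl

theorem narayanaQuat_sum (n : ℕ) :
    ∑ l ∈ Finset.range (n + 1), narayanaQuat l =
      narayanaQuat (n + 3) - ⟨1, 1, 2, 3⟩ := by
  induction n with
  | zero =>
    rw [zero_add, Finset.sum_range_one]
    apply QuaternionAlgebra.ext
    · change narayana 0 = narayana 3 - 1
      norm_num [narayana]
    · change narayana 1 = narayana 4 - 1
      norm_num [narayana]
    · change narayana 2 = narayana 5 - 2
      norm_num [narayana]
    · change narayana 3 = narayana 6 - 3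
      norm_num [narayana]
  | succ n ih =>
    rw [Finset.sum_range_succ, ih, show n + 1 + 3 = n + 4 from rfl, narayanaQuat_add_four]
    exact sub_add_eq_add_sub _ _ _
end

section
/- Let P_n be the Padovan-Perrin sequence (P_0 = 0, P_1 = 1, P_2 = 0, P_n = P_{n-2} + P_{n-3} for n ≥ 3) and let Q_n = P_n + P_{n+1}·i + P_{n+2}·j + P_{n+3}·k be the Padovan-Perrin quaternion. Then for every n ≥ 0, Σ_{l=0}^{n} Q_l = Q_{n+5} − (1 + i + 2j + 2k). -/
/-- The Padovan-Perrin sequence: `P 0 = 0`, `P 1 = 1`, `P 2 = 0`, `P n = P (n-2) + P (n-3)`. -/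
def padovanPerrin : ℕ → ℝ
  | 0 => 0
  | 1 => 1
  | 2 => 0
  | (n+3) => padovanPerrin (n+1) + padovanPerrin n

/-- The Padovan-Perrin quaternion `Q_n = P_n + P_{n+1} i + P_{n+2} j + P_{n+3} k`. -/
noncomputable def padovanPerrinQuat (n : ℕ) : Quaternion ℝ :=
  ⟨padovanPerrin n, padovanPerrin (n+1), padovanPerrin (n+2), padovanPerrin (n+3)⟩

theorem padovanPerrin_add_three (n : ℕ) :
    padovanPerrin (n + 3) = padovanPerrin (n + 1) + padovanPerrin n := by
  rw [padovanPerrin]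

theorem padovanPerrin_add_five (n : ℕ) :
    padovanPerrin (n + 5) = padovanPerrin (n + 4) + padovanPerrin n := by
  linarith [padovanPerrin_add_three n, padovanPerrin_add_three (n + 1),
    padovanPerrin_add_three (n + 2)]

theorem padovanPerrinQuat_add_five (n : ℕ) :
    padovanPerrinQuat (n + 5) = padovanPerrinQuat (n + 4) + padovanPerrinQuat n := by
  ext
  · exact padovanPerrin_add_five n
  · exact padovanPerrin_add_five (n + 1)
  · exact padovanPerrin_add_five (n + 2)
  · exact padovanPerrin_add_five (n + 3)

theorem padovanPerrinQuat_sum (n : ℕ) :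
    ∑ l ∈ Finset.range (n + 1), padovanPerrinQuat l =
      padovanPerrinQuat (n + 5) - ⟨1, 1, 2, 2⟩ := by
  induction n with
  | zero =>
    rw [zero_add, Finset.sum_range_one, zero_add]
    ext
    · refine Eq.trans ?_ (QuaternionAlgebra.re_sub (padovanPerrinQuat 5) _).symm
      norm_num [padovanPerrinQuat, padovanPerrin]
    · refine Eq.trans ?_ (QuaternionAlgebra.imI_sub (padovanPerrinQuat 5) _).symm
      norm_num [padovanPerrinQuat, padovanPerrin]
    · refine Eq.trans ?_ (QuaternionAlgebra.imJ_sub (padovanPerrinQuat 5) _).symm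
      norm_num [padovanPerrinQuat, padovanPerrin]
    · refine Eq.trans ?_ (QuaternionAlgebra.imK_sub (padovanPerrinQuat 5) _).symm
      norm_num [padovanPerrinQuat, padovanPerrin]
  | succ k ih =>
    rw [Finset.sum_range_succ, ih, padovanPerrinQuat_add_five (k + 1)]
    exact sub_add_eq_add_sub (padovanPerrinQuat (k + 5)) _ (padovanPerrinQuat (k + 1))
end

section
/- Let J_n be the third order Jacobsthal sequence (J_0 = 0, J_1 = 1, J_2 = 1, J_n = J_{n-1} + J_{n-2} + 2·J_{n-3} for n ≥ 3) and let Q_n = J_n + J_{n+1}·i + J_{n+2}·j + J_{n+3}·k be the third order Jacobsthal quaternion. Then for every n ≥ 0, Σ_{l=0}^{n} Q_l = (1/3)·(Q_{n+2} + 2·Q_n − (1 + i + 4j + 7k)). -/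
/-- The third order Jacobsthal sequence: `J 0 = 0`, `J 1 = 1`, `J 2 = 1`,
`J n = J (n-1) + J (n-2) + 2 J (n-3)`. -/
def jacobsthal3 : ℕ → ℝ
  | 0 => 0
  | 1 => 1
  | 2 => 1
  | (n+3) => jacobsthal3 (n+2) + jacobsthal3 (n+1) + 2 * jacobsthal3 n

/-- The third order Jacobsthal quaternion `Q_n = J_n + J_{n+1} i + J_{n+2} j + J_{n+3} k`. -/
noncomputable def jacobsthal3Quat (n : ℕ) : Quaternion ℝ :=
  ⟨jacobsthal3 n, jacobsthal3 (n+1), jacobsthal3 (n+2), jacobsthal3 (n+3)⟩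

theorem jacobsthal3_add_three (n : ℕ) :
    jacobsthal3 (n + 3) = jacobsthal3 (n + 2) + jacobsthal3 (n + 1) + 2 * jacobsthal3 n := by
  rw [jacobsthal3]

theorem jacobsthal3Quat_add_three (n : ℕ) :
    jacobsthal3Quat (n + 3) =
      jacobsthal3Quat (n + 2) + jacobsthal3Quat (n + 1) + (2 : ℝ) • jacobsthal3Quat n := by
  ext
  · exact jacobsthal3_add_three n
  · exact jacobsthal3_add_three (n + 1)
  · exact jacobsthal3_add_three (n + 2)
  · exact jacobsthal3_add_three (n + 3)

theorem jacobsthal3Quat_sum (n : ℕ) :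
    ∑ l ∈ Finset.range (n + 1), jacobsthal3Quat l =
      (1 / 3 : ℝ) • (jacobsthal3Quat (n + 2) + (2 : ℝ) • jacobsthal3Quat n - ⟨1, 1, 4, 7⟩) := by
  induction n with
  | zero =>
    rw [zero_add, Finset.sum_range_one]
    ext <;> change (_ : ℝ) = 1 / 3 * (_ + 2 * _ - _) <;>
      norm_num [jacobsthal3Quat, jacobsthal3]
  | succ n ih =>
    rw [Finset.sum_range_succ, ih, show n + 1 + 2 = n + 3 from rfl, jacobsthal3Quat_add_three]
    ext <;> change (1 / 3 * (_ + 2 * _ - _) + _ : ℝ) = 1 / 3 * (_ + _ + 2 * _ + 2 * _ - _) <;>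
      ring
end

section
/- Let J_n be the third order Jacobsthal sequence (J_0 = 0, J_1 = 1, J_2 = 1, J_n = J_{n-1} + J_{n-2} + 2·J_{n-3} for n ≥ 3) and let JQ_n = J_n + J_{n+1}·i + J_{n+2}·j + J_{n+3}·k, regarded as a quaternion over ℂ. Let x₁ = (−1 + √3·𝕚)/2 and x₂ = (−1 − √3·𝕚)/2 be the two complex roots of x² + x + 1 = 0 (𝕚 denoting the complex imaginary unit), and set u₂ = 1 + 2i + 4j + 8k, u₁ = 1 + x₁·i + x₁²·j + k, and u₂' = 1 + x₂·i + x₂²·j + k as quaternions over ℂ. Then for every n ≥ 0, JQ_n = (1/7)·[ 2^{n+1}·u₂ − (1 + (2√3/3)·𝕚)·x₁ⁿ·u₁ − (1 − (2√3/3)·𝕚)·x₂ⁿ·u₂' ]. -/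
/-- The third order Jacobsthal quaternion `JQ_n = J_n + J_{n+1} i + J_{n+2} j + J_{n+3} k`,
regarded as a quaternion over `ℂ`. -/
noncomputable def jacobsthal3QuatC (n : ℕ) : Quaternion ℂ :=
  ⟨(jacobsthal3 n : ℂ), (jacobsthal3 (n+1) : ℂ), (jacobsthal3 (n+2) : ℂ), (jacobsthal3 (n+3) : ℂ)⟩

/-- Binet's formula for the third order Jacobsthal sequence, with `s` a square root of `3`. -/
theorem jacobsthal3_binet {s x y : ℂ} (hs : s ^ 2 = 3)
    (hx : x = (-1 + s * Complex.I) / 2) (hy : y = (-1 - s * Complex.I) / 2) :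
    ∀ n : ℕ, (jacobsthal3 n : ℂ) =
      1 / 7 * (2 ^ (n + 1) - (1 + (2 * s / 3) * Complex.I) * x ^ n
        - (1 - (2 * s / 3) * Complex.I) * y ^ n)
  | 0 => by
    simp only [jacobsthal3]
    push_cast
    ring
  | 1 => by
    simp only [jacobsthal3, hx, hy]
    push_cast
    linear_combination (2 / 21 : ℂ) * Complex.I ^ 2 * hs + (2 / 7 : ℂ) * Complex.I_sq
  | 2 => by
    simp only [jacobsthal3, hx, hy]
    push_cast
    linear_combination (-1 / 42 : ℂ) * Complex.I ^ 2 * hs + (-1 / 14 : ℂ) * Complex.I_sq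
  | n + 3 => by
    have hx' : x ^ 2 + x + 1 = 0 := by
      rw [hx]
      linear_combination (1 / 4 : ℂ) * Complex.I ^ 2 * hs + (3 / 4 : ℂ) * Complex.I_sq
    have hy' : y ^ 2 + y + 1 = 0 := by
      rw [hy]
      linear_combination (1 / 4 : ℂ) * Complex.I ^ 2 * hs + (3 / 4 : ℂ) * Complex.I_sq
    rw [jacobsthal3]
    push_cast
    rw [jacobsthal3_binet hs hx hy n, jacobsthal3_binet hs hx hy (n + 1),
      jacobsthal3_binet hs hx hy (n + 2)]
    linear_combination
      (1 / 7 : ℂ) * (1 + (2 * s / 3) * Complex.I) * x ^ n * (x - 2) * hx'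
        + (1 / 7 : ℂ) * (1 - (2 * s / 3) * Complex.I) * y ^ n * (y - 2) * hy'

theorem jacobsthal3Quat_binet (x₁ x₂ : ℂ)
    (hx₁ : x₁ = (-1 + Real.sqrt 3 * Complex.I) / 2)
    (hx₂ : x₂ = (-1 - Real.sqrt 3 * Complex.I) / 2)
    (u₂ u₁ u₂' : Quaternion ℂ)
    (hu₂ : u₂ = ⟨1, 2, 4, 8⟩)
    (hu₁ : u₁ = ⟨1, x₁, x₁ ^ 2, 1⟩)
    (hu₂' : u₂' = ⟨1, x₂, x₂ ^ 2, 1⟩) (n : ℕ) :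
    jacobsthal3QuatC n =
      (1 / 7 : ℂ) • ((2 : ℂ) ^ (n + 1) • u₂
        - ((1 + (2 * Real.sqrt 3 / 3) * Complex.I) * x₁ ^ n) • u₁
        - ((1 - (2 * Real.sqrt 3 / 3) * Complex.I) * x₂ ^ n) • u₂') := by
  have hs : ((Real.sqrt 3 : ℝ) : ℂ) ^ 2 = 3 := by
    rw [← Complex.ofReal_pow, Real.sq_sqrt (by norm_num)]
    norm_num
  have hx₁' : x₁ ^ 3 = 1 := by
    rw [hx₁]
    linear_combination (Complex.I ^ 2 * hs + 3 * Complex.I_sq) *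
      (-3 + Real.sqrt 3 * Complex.I) / 8
  have hx₂' : x₂ ^ 3 = 1 := by
    rw [hx₂]
    linear_combination (Complex.I ^ 2 * hs + 3 * Complex.I_sq) *
      (-3 - Real.sqrt 3 * Complex.I) / 8
  have h := jacobsthal3_binet hs hx₁ hx₂
  clear hx₁ hx₂
  ext
  · have e : u₂.re = 1 := by rw [hu₂]
    have e₁ : u₁.re = 1 := by rw [hu₁]
    have e₂ : u₂'.re = 1 := by rw [hu₂']
    simp only [jacobsthal3QuatC, h, Quaternion.re_smul, Quaternion.re_sub, smul_eq_mul, e, e₁, e₂]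
    ring
  · have e : u₂.imI = 2 := by rw [hu₂]
    have e₁ : u₁.imI = x₁ := by rw [hu₁]
    have e₂ : u₂'.imI = x₂ := by rw [hu₂']
    simp only [jacobsthal3QuatC, h, Quaternion.imI_smul, Quaternion.imI_sub, smul_eq_mul, e, e₁, e₂]
    ring
  · have e : u₂.imJ = 4 := by rw [hu₂]
    have e₁ : u₁.imJ = x₁ ^ 2 := by rw [hu₁]
    have e₂ : u₂'.imJ = x₂ ^ 2 := by rw [hu₂']
    simp only [jacobsthal3QuatC, h, Quaternion.imJ_smul, Quaternion.imJ_sub, smul_eq_mul, e, e₁, e₂]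
    ring
  · have e : u₂.imK = 8 := by rw [hu₂]
    have e₁ : u₁.imK = 1 := by rw [hu₁]
    have e₂ : u₂'.imK = 1 := by rw [hu₂']
    simp only [jacobsthal3QuatC, h, Quaternion.imK_smul, Quaternion.imK_sub, smul_eq_mul, e, e₁, e₂, pow_add _ n 3, hx₁', hx₂']
    ring
end
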